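/- For every integer n ≥ 3, every optimal set of n-means for the condensation measure P contains no point of the open interval (1/5, 2/5) and no point of the open interval (3/5, 4/5). -/

import Mathlib

open MeasureTheory Metric Set Filter

/-- The distortion error of a set `α` of quantizer points for `μ`, of order 2:
`∫ min_{a ∈ α} (x - a)^2 dμ(x)`. -/
noncomputable def distortion (μ : MeasureTheory.Measure ℝ) (α : Set ℝ) : ℝ :=
  ∫ x, (Metric.infDist x α) ^ 2 ∂μ

/-- The `n`th quantization error of order 2 for `μ`. -/
noncomputable def quantErr (μ : MeasureTheory.Measure ℝ) (n : ℕ) : ℝ :=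
  sInf {e : ℝ | ∃ α : Set ℝ, α.Finite ∧ α.Nonempty ∧ α.ncard ≤ n ∧ e = distortion μ α}

/-- `α` is an optimal set of `n`-means for `μ`. -/
def IsOptimalSet (μ : MeasureTheory.Measure ℝ) (n : ℕ) (α : Set ℝ) : Prop :=
  α.Finite ∧ α.Nonempty ∧ α.ncard ≤ n ∧ distortion μ α = quantErr μ n

/-- The similarity `S₁(x) = x/5`. -/
noncomputable def S1 : ℝ → ℝ := fun x => x / 5

/-- The similarity `S₂(x) = x/5 + 4/5`. -/
noncomputable def S2 : ℝ → ℝ := fun x => x / 5 + 4 / 5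

/-- `P` is the condensation measure associated with `(S₁, S₂; 1/3, 1/3, 1/3; ν)`:
`P = (1/3) P∘S₁⁻¹ + (1/3) P∘S₂⁻¹ + (1/3) ν`. -/
def IsCondensation (P ν : MeasureTheory.Measure ℝ) : Prop :=
  MeasureTheory.IsProbabilityMeasure P ∧
    P = (1 / 3 : ENNReal) • P.map S1 + (1 / 3 : ENNReal) • P.map S2 + (1 / 3 : ENNReal) • ν

/-- The point `a_{j+1} = 3/5 - 1/(5 · 2^j)` (so `aseq 0 = a₁ = 2/5`). -/
noncomputable def aseq (j : ℕ) : ℝ := 3 / 5 - 1 / (5 * 2 ^ j)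

/-- The infinite discrete distribution `ν = ∑_{j ≥ 1} 2^{-j} δ_{a_j}`. -/
noncomputable def nuDisc : MeasureTheory.Measure ℝ :=
  MeasureTheory.Measure.sum
    (fun j : ℕ => ((1 / 2 : ENNReal) ^ (j + 1)) • MeasureTheory.Measure.dirac (aseq j))

/-- The squared distance from `x` to the set `α`. -/
noncomputable def sqDist (α : Set ℝ) (x : ℝ) : ℝ := Metric.infDist x α ^ 2

lemma continuous_sqDist (α : Set ℝ) : Continuous (sqDist α) :=
  (Metric.continuous_infDist_pt α).pow 2

lemma sqDist_nonneg (α : Set ℝ) (x : ℝ) : 0 ≤ sqDist α x := sq_nonneg _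

lemma sqDist_le {α : Set ℝ} {b : ℝ} (hb : b ∈ α) (x : ℝ) : sqDist α x ≤ (x - b) ^ 2 := by
  rw [← sq_abs (x - b), ← Real.dist_eq]
  exact pow_le_pow_left₀ Metric.infDist_nonneg (Metric.infDist_le_dist_of_mem hb) 2

lemma exists_sqDist_eq {α : Set ℝ} (hf : α.Finite) (hne : α.Nonempty) (x : ℝ) :
    ∃ b ∈ α, sqDist α x = (x - b) ^ 2 := by
  obtain ⟨b, hb, h⟩ := hf.isCompact.exists_infDist_eq_dist hne x
  exact ⟨b, hb, by rw [sqDist, h, Real.dist_eq, sq_abs]⟩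

lemma le_sqDist {α : Set ℝ} (hf : α.Finite) (hne : α.Nonempty) {x q : ℝ}
    (h : ∀ b ∈ α, q ≤ (x - b) ^ 2) : q ≤ sqDist α x := by
  obtain ⟨b, hb, hx⟩ := exists_sqDist_eq hf hne x
  exact hx ▸ h b hb

lemma sq_le_sqDist {α : Set ℝ} (hf : α.Finite) (hne : α.Nonempty) {x q : ℝ} (hq : 0 ≤ q)
    (h : ∀ b ∈ α, q ≤ x - b ∨ q ≤ b - x) : q ^ 2 ≤ sqDist α x :=
  le_sqDist hf hne fun b hb => (h b hb).elim (fun h => pow_le_pow_left₀ hq h 2)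
    fun h => (sub_sq_comm x b) ▸ pow_le_pow_left₀ hq h 2

lemma aseq_zero : aseq 0 = 2 / 5 := by norm_num [aseq]

lemma aseq_succ (j : ℕ) : aseq (j + 1) = (aseq j + 3 / 5) / 2 := by
  simp only [aseq, pow_succ]
  field_simp
  ring

lemma aseq_mem (j : ℕ) : aseq j ∈ Icc (2 / 5 : ℝ) (3 / 5) := by
  induction j with
  | zero => norm_num [aseq]
  | succ j ih =>
    rw [aseq_succ]
    exact ⟨by linarith [ih.1, ih.2], by linarith [ih.1, ih.2]⟩

lemma aseq_strictMono : StrictMono aseq := by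
  refine strictMono_nat_of_lt_succ fun j => ?_
  have : aseq j < 3 / 5 := by
    have : (0 : ℝ) < 1 / (5 * 2 ^ j) := by positivity
    simp only [aseq]
    linarith
  rw [aseq_succ]
  linarith

lemma ae_nuDisc_mem : ∀ᵐ x ∂nuDisc, x ∈ Icc (2 / 5 : ℝ) (3 / 5) := by
  refine (Measure.ae_sum_iff' measurableSet_Icc).2 fun j => ?_
  refine Measure.ae_smul_measure ?_ _
  rw [ae_dirac_iff measurableSet_Icc]
  exact aseq_mem j

lemma nuDisc_eq : nuDisc = (1 / 2 : ENNReal) • Measure.dirac (2 / 5 : ℝ) +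
    (1 / 2 : ENNReal) • nuDisc.map (fun x => (x + 3 / 5) / 2) := by
  have hm : Measurable fun x : ℝ => (x + 3 / 5) / 2 := by fun_prop
  ext s hs
  rw [Measure.add_apply, Measure.smul_apply, Measure.smul_apply, Measure.map_apply hm hs,
    nuDisc, Measure.sum_apply _ hs, Measure.sum_apply _ (hm hs),
    tsum_eq_zero_add' ENNReal.summable, smul_eq_mul, smul_eq_mul, ← ENNReal.tsum_mul_left]
  congr 1
  · simp [aseq_zero]
  · refine tsum_congr fun j => ?_
    simp only [Measure.smul_apply, smul_eq_mul, Measure.dirac_apply' _ hs,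
      Measure.dirac_apply' _ (hm hs), aseq_succ]
    rw [pow_succ' _ (j + 1), mul_assoc]
    rfl

lemma nuDisc_singleton_ne_zero (j : ℕ) : nuDisc {aseq j} ≠ 0 := by
  rw [nuDisc, Measure.sum_apply _ (measurableSet_singleton _)]
  intro h
  have := ENNReal.tsum_eq_zero.1 h j
  simp at this

section Condensation

variable {P : Measure ℝ}

lemma IsCondensation.apply (hP : IsCondensation P nuDisc) {s : Set ℝ} (hs : MeasurableSet s) :
    P s = 1 / 3 * P ((fun x => x / 5) ⁻¹' s) + 1 / 3 * P ((fun x => x / 5 + 4 / 5) ⁻¹' s) +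
      1 / 3 * nuDisc s := by
  have h1 : Measurable S1 := by unfold S1; fun_prop
  have h2 : Measurable S2 := by unfold S2; fun_prop
  conv_lhs => rw [hP.2]
  rw [Measure.add_apply, Measure.add_apply, Measure.smul_apply, Measure.smul_apply,
    Measure.smul_apply, Measure.map_apply h1 hs, Measure.map_apply h2 hs]
  rfl

lemma IsCondensation.nuDisc_univ (hP : IsCondensation P nuDisc) : nuDisc univ = 1 := by
  have := hP.1
  have h := hP.apply MeasurableSet.univ
  simp only [preimage_univ, measure_univ, mul_one] at h
  have ht : nuDisc univ ≠ ⊤ := by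
    intro ht
    rw [ht, ENNReal.mul_top (by simp)] at h
    simp at h
  have h' := congrArg ENNReal.toReal h
  rw [ENNReal.toReal_add (by simp) (ENNReal.mul_ne_top (by simp) ht),
    ENNReal.toReal_add (by simp) (by simp), ENNReal.toReal_mul] at h'
  simp only [ENNReal.toReal_one, one_div, ENNReal.toReal_inv, ENNReal.toReal_ofNat] at h'
  rw [← ENNReal.toReal_eq_one_iff]
  linarith

lemma IsCondensation.isProbabilityMeasure_nuDisc (hP : IsCondensation P nuDisc) :
    IsProbabilityMeasure nuDisc := ⟨hP.nuDisc_univ⟩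

lemma IsCondensation.ae_mem_Icc (hP : IsCondensation P nuDisc) :
    ∀ᵐ x ∂P, x ∈ Icc (0 : ℝ) 1 := by
  have := hP.1
  have hK : MeasurableSet (Icc (0 : ℝ) 1)ᶜ := measurableSet_Icc.compl
  have h := hP.apply hK
  have hν : nuDisc (Icc (0 : ℝ) 1)ᶜ = 0 := by
    refine measure_mono_null ?_ (ae_iff.1 ae_nuDisc_mem)
    intro x hx hx'
    exact hx ⟨by linarith [hx'.1], by linarith [hx'.2]⟩
  have h1 : P ((fun x => x / 5) ⁻¹' (Icc (0 : ℝ) 1)ᶜ) ≤ P (Icc (0 : ℝ) 1)ᶜ := by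
    refine measure_mono fun x hx hx' => hx ⟨?_, ?_⟩
    · linarith [hx'.1]
    · linarith [hx'.2]
  have h2 : P ((fun x => x / 5 + 4 / 5) ⁻¹' (Icc (0 : ℝ) 1)ᶜ) ≤ P (Icc (0 : ℝ) 1)ᶜ := by
    refine measure_mono fun x hx hx' => hx ⟨?_, ?_⟩
    · linarith [hx'.1]
    · linarith [hx'.2]
  rw [hν, mul_zero, add_zero] at h
  have hle : P (Icc (0 : ℝ) 1)ᶜ ≤ 1 / 3 * P (Icc (0 : ℝ) 1)ᶜ + 1 / 3 * P (Icc (0 : ℝ) 1)ᶜ := by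
    conv_lhs => rw [h]
    gcongr
  have hne : P (Icc (0 : ℝ) 1)ᶜ ≠ ⊤ := measure_ne_top _ _
  have hm : (1 / 3 : ENNReal) * P (Icc (0 : ℝ) 1)ᶜ ≠ ⊤ := ENNReal.mul_ne_top (by simp) hne
  have h' := ENNReal.toReal_mono (ENNReal.add_ne_top.2 ⟨hm, hm⟩) hle
  rw [ENNReal.toReal_add hm hm, ENNReal.toReal_mul] at h'
  simp only [one_div, ENNReal.toReal_inv, ENNReal.toReal_ofNat] at h'
  have h0 : (P (Icc (0 : ℝ) 1)ᶜ).toReal = 0 := by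
    linarith [ENNReal.toReal_nonneg (a := P (Icc (0 : ℝ) 1)ᶜ)]
  exact ((ENNReal.toReal_eq_zero_iff _).1 h0).resolve_right hne

/-- The measure `P` lives on the three pieces `[0, 1/5]`, `[2/5, 3/5]` and `[4/5, 1]`. -/
lemma IsCondensation.ae_mem_pieces (hP : IsCondensation P nuDisc) :
    ∀ᵐ x ∂P, x ∈ Icc (0 : ℝ) (1 / 5) ∪ Icc (2 / 5) (3 / 5) ∪ Icc (4 / 5) 1 := by
  have hK : MeasurableSet
      (Icc (0 : ℝ) (1 / 5) ∪ Icc (2 / 5) (3 / 5) ∪ Icc (4 / 5) 1) := by measurability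
  have hI := ae_iff.1 hP.ae_mem_Icc
  change P (Icc (0 : ℝ) (1 / 5) ∪ Icc (2 / 5) (3 / 5) ∪ Icc (4 / 5) 1)ᶜ = 0
  rw [hP.apply hK.compl, measure_mono_null _ hI, measure_mono_null _ hI,
    measure_mono_null _ (ae_iff.1 ae_nuDisc_mem)]
  · simp
  · exact fun x hx hx' => hx (Or.inl (Or.inr hx'))
  · intro x hx hx'
    refine hx (Or.inr ⟨?_, ?_⟩)
    · linarith [hx'.1]
    · linarith [hx'.2]
  · intro x hx hx'
    refine hx (Or.inl (Or.inl ⟨?_, ?_⟩))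
    · linarith [hx'.1]
    · linarith [hx'.2]

lemma integrable_of_ae_mem_Icc {μ : Measure ℝ} [IsFiniteMeasure μ] {a b : ℝ}
    (hμ : ∀ᵐ x ∂μ, x ∈ Icc a b) {f : ℝ → ℝ} (hf : Continuous f) : Integrable f μ := by
  obtain ⟨C, hC⟩ := isCompact_Icc.exists_bound_of_continuousOn (s := Icc a b) hf.continuousOn
  exact Integrable.of_bound hf.aestronglyMeasurable C (hμ.mono hC)

lemma IsCondensation.integrable (hP : IsCondensation P nuDisc) {f : ℝ → ℝ} (hf : Continuous f) :
    Integrable f P :=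
  have := hP.1
  integrable_of_ae_mem_Icc hP.ae_mem_Icc hf

lemma IsCondensation.integrable_nuDisc (hP : IsCondensation P nuDisc) {f : ℝ → ℝ}
    (hf : Continuous f) : Integrable f nuDisc :=
  have := hP.isProbabilityMeasure_nuDisc
  integrable_of_ae_mem_Icc ae_nuDisc_mem hf

lemma IsCondensation.integral_eq (hP : IsCondensation P nuDisc) {f : ℝ → ℝ} (hf : Continuous f) :
    3 * ∫ x, f x ∂P =
      ∫ x, f (x / 5) ∂P + ∫ x, f (x / 5 + 4 / 5) ∂P + ∫ x, f x ∂nuDisc := by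
  have h1 : Continuous S1 := by unfold S1; fun_prop
  have h2 : Continuous S2 := by unfold S2; fun_prop
  have i1 : Integrable f (P.map S1) :=
    (integrable_map_measure hf.aestronglyMeasurable h1.measurable.aemeasurable).2
      (hP.integrable (hf.comp h1))
  have i2 : Integrable f (P.map S2) :=
    (integrable_map_measure hf.aestronglyMeasurable h2.measurable.aemeasurable).2
      (hP.integrable (hf.comp h2))
  have i3 := hP.integrable_nuDisc hf
  have t : (1 / 3 : ENNReal) ≠ ⊤ := by simp
  have e : ∫ x, f x ∂P = ∫ x, f x ∂((1 / 3 : ENNReal) • P.map S1 + (1 / 3 : ENNReal) • P.map S2 +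
      (1 / 3 : ENNReal) • nuDisc) := congrArg (fun μ => ∫ x, f x ∂μ) hP.2
  rw [e, integral_add_measure ((i1.smul_measure t).add_measure (i2.smul_measure t))
    (i3.smul_measure t), integral_add_measure (i1.smul_measure t) (i2.smul_measure t),
    integral_smul_measure, integral_smul_measure, integral_smul_measure,
    integral_map h1.measurable.aemeasurable hf.aestronglyMeasurable,
    integral_map h2.measurable.aemeasurable hf.aestronglyMeasurable]
  simp only [one_div, ENNReal.toReal_inv, ENNReal.toReal_ofNat, smul_eq_mul, S1, S2]
  ring

lemma IsCondensation.integral_nuDisc_eq (hP : IsCondensation P nuDisc) {f : ℝ → ℝ}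
    (hf : Continuous f) :
    ∫ x, f x ∂nuDisc = f (2 / 5) / 2 + (∫ x, f ((x + 3 / 5) / 2) ∂nuDisc) / 2 := by
  have h1 : Continuous fun x : ℝ => (x + 3 / 5) / 2 := by fun_prop
  have i1 : Integrable f (nuDisc.map fun x => (x + 3 / 5) / 2) :=
    (integrable_map_measure hf.aestronglyMeasurable h1.measurable.aemeasurable).2
      (hP.integrable_nuDisc (hf.comp h1))
  have i2 : Integrable f (Measure.dirac (2 / 5 : ℝ)) :=
    integrable_of_ae_mem_Icc (a := 2 / 5) (b := 2 / 5)
      ((ae_dirac_iff measurableSet_Icc).2 (by simp)) hf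
  have t : (1 / 2 : ENNReal) ≠ ⊤ := by simp
  have e : ∫ x, f x ∂nuDisc = ∫ x, f x ∂((1 / 2 : ENNReal) • Measure.dirac (2 / 5 : ℝ) +
      (1 / 2 : ENNReal) • nuDisc.map (fun x => (x + 3 / 5) / 2)) :=
    congrArg (fun μ => ∫ x, f x ∂μ) nuDisc_eq
  rw [e, integral_add_measure (i2.smul_measure t) (i1.smul_measure t),
    integral_smul_measure, integral_smul_measure, integral_dirac,
    integral_map h1.measurable.aemeasurable hf.aestronglyMeasurable]
  simp only [one_div, ENNReal.toReal_inv, ENNReal.toReal_ofNat, smul_eq_mul]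
  ring

lemma integral_affine_sq_aux {μ : Measure ℝ} [IsProbabilityMeasure μ]
    (hi : ∀ f : ℝ → ℝ, Continuous f → Integrable f μ) (p q : ℝ) :
    ∫ x, (p * x + q) ^ 2 ∂μ = p ^ 2 * ∫ x, x ^ 2 ∂μ + 2 * p * q * ∫ x, x ∂μ + q ^ 2 := by
  have e : (fun x : ℝ => (p * x + q) ^ 2) =
      fun x => p ^ 2 * x ^ 2 + 2 * p * q * x + q ^ 2 := by
    funext x; ring
  rw [e, integral_add (hi _ (by fun_prop)) (hi _ (by fun_prop)),
    integral_add (hi _ (by fun_prop)) (hi _ (by fun_prop)), integral_const_mul,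
    integral_const_mul]
  simp

lemma integral_affine_aux {μ : Measure ℝ} [IsProbabilityMeasure μ]
    (hi : ∀ f : ℝ → ℝ, Continuous f → Integrable f μ) (p q : ℝ) :
    ∫ x, (p * x + q) ∂μ = p * ∫ x, x ∂μ + q := by
  rw [integral_add (hi _ (by fun_prop)) (hi _ (by fun_prop)), integral_const_mul]
  simp

lemma IsCondensation.integral_affine_sq_nuDisc (hP : IsCondensation P nuDisc) (p q : ℝ) :
    ∫ x, (p * x + q) ^ 2 ∂nuDisc = p ^ 2 * (39 / 175) + 2 * p * q * (7 / 15) + q ^ 2 := by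
  have := hP.isProbabilityMeasure_nuDisc
  have hi : ∀ f : ℝ → ℝ, Continuous f → Integrable f nuDisc := fun f hf => hP.integrable_nuDisc hf
  have h1 := hP.integral_nuDisc_eq (f := fun x => x) (by fun_prop)
  have h2 := hP.integral_nuDisc_eq (f := fun x => x ^ 2) (by fun_prop)
  have e : ∀ x : ℝ, (x + 3 / 5) / 2 = 1 / 2 * x + 3 / 10 := fun x => by ring
  simp only [e, integral_affine_aux hi, integral_affine_sq_aux hi] at h1 h2
  have m1 : ∫ x, x ∂nuDisc = 7 / 15 := by linarith
  have m2 : ∫ x, x ^ 2 ∂nuDisc = 39 / 175 := by rw [m1] at h2; linarith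
  rw [integral_affine_sq_aux hi, m1, m2]

lemma IsCondensation.integral_affine_sq (hP : IsCondensation P nuDisc) (p q : ℝ) :
    ∫ x, (p * x + q) ^ 2 ∂P = p ^ 2 * (6953 / 19929) + 2 * p * q * (19 / 39) + q ^ 2 := by
  have := hP.1
  have := hP.isProbabilityMeasure_nuDisc
  have hi : ∀ f : ℝ → ℝ, Continuous f → Integrable f P := fun f hf => hP.integrable hf
  have n1 : ∫ x, x ∂nuDisc = 7 / 15 := by
    have h1 := integral_affine_sq_aux (fun f hf => hP.integrable_nuDisc hf) 1 1
    have h2 := integral_affine_sq_aux (fun f hf => hP.integrable_nuDisc hf) 1 (-1)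
    rw [hP.integral_affine_sq_nuDisc] at h1 h2
    linarith
  have n2 := hP.integral_affine_sq_nuDisc 1 0
  have h1 := hP.integral_eq (f := fun x => x) (by fun_prop)
  have h2 := hP.integral_eq (f := fun x => x ^ 2) (by fun_prop)
  have e1 : ∀ x : ℝ, x / 5 + 4 / 5 = 1 / 5 * x + 4 / 5 := fun x => by ring
  simp only [e1, div_pow, integral_div, integral_affine_aux hi, integral_affine_sq_aux hi,
    n1] at h1 h2
  simp only [one_mul, add_zero] at n2
  have m1 : ∫ x, x ∂P = 19 / 39 := by linarith
  have m2 : ∫ x, x ^ 2 ∂P = 6953 / 19929 := by rw [m1, n2] at h2; linarith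
  rw [integral_affine_sq_aux hi, m1, m2]

lemma IsCondensation.integral_mono (hP : IsCondensation P nuDisc) {f g : ℝ → ℝ}
    (hf : Continuous f) (hg : Continuous g) (h : ∀ x ∈ Icc (0 : ℝ) 1, f x ≤ g x) :
    ∫ x, f x ∂P ≤ ∫ x, g x ∂P :=
  integral_mono_ae (hP.integrable hf) (hP.integrable hg) (hP.ae_mem_Icc.mono h)

lemma IsCondensation.integral_nuDisc_mono (hP : IsCondensation P nuDisc) {f g : ℝ → ℝ}
    (hf : Continuous f) (hg : Continuous g) (h : ∀ x ∈ Icc (2 / 5 : ℝ) (3 / 5), f x ≤ g x) :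
    ∫ x, f x ∂nuDisc ≤ ∫ x, g x ∂nuDisc :=
  integral_mono_ae (hP.integrable_nuDisc hf) (hP.integrable_nuDisc hg) (ae_nuDisc_mem.mono h)

lemma IsCondensation.le_integral (hP : IsCondensation P nuDisc) {f : ℝ → ℝ}
    (hf : Continuous f) (p q : ℝ) (h : ∀ x ∈ Icc (0 : ℝ) 1, (p * x + q) ^ 2 ≤ f x) :
    p ^ 2 * (6953 / 19929) + 2 * p * q * (19 / 39) + q ^ 2 ≤ ∫ x, f x ∂P :=
  hP.integral_affine_sq p q ▸ hP.integral_mono (by fun_prop) hf h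

lemma IsCondensation.le_integral_nuDisc (hP : IsCondensation P nuDisc) {f : ℝ → ℝ}
    (hf : Continuous f) (p q : ℝ) (h : ∀ x ∈ Icc (2 / 5 : ℝ) (3 / 5), (p * x + q) ^ 2 ≤ f x) :
    p ^ 2 * (39 / 175) + 2 * p * q * (7 / 15) + q ^ 2 ≤ ∫ x, f x ∂nuDisc :=
  hP.integral_affine_sq_nuDisc p q ▸ hP.integral_nuDisc_mono (by fun_prop) hf h

lemma IsCondensation.integral_le (hP : IsCondensation P nuDisc) {f : ℝ → ℝ}
    (hf : Continuous f) (p q : ℝ) (h : ∀ x ∈ Icc (0 : ℝ) 1, f x ≤ (p * x + q) ^ 2) :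
    ∫ x, f x ∂P ≤ p ^ 2 * (6953 / 19929) + 2 * p * q * (19 / 39) + q ^ 2 :=
  hP.integral_affine_sq p q ▸ hP.integral_mono hf (by fun_prop) h

lemma IsCondensation.integral_nuDisc_le (hP : IsCondensation P nuDisc) {f : ℝ → ℝ}
    (hf : Continuous f) (p q : ℝ) (h : ∀ x ∈ Icc (2 / 5 : ℝ) (3 / 5), f x ≤ (p * x + q) ^ 2) :
    ∫ x, f x ∂nuDisc ≤ p ^ 2 * (39 / 175) + 2 * p * q * (7 / 15) + q ^ 2 :=
  hP.integral_affine_sq_nuDisc p q ▸ hP.integral_nuDisc_mono hf (by fun_prop) h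

lemma IsOptimalSet.distortion_le {n : ℕ} {α β : Set ℝ} (hα : IsOptimalSet P n α)
    (hβ : β.Finite) (hne : β.Nonempty) (hc : β.ncard ≤ n) : distortion P α ≤ distortion P β := by
  rw [hα.2.2.2]
  refine csInf_le ⟨0, ?_⟩ ⟨β, hβ, hne, hc, rfl⟩
  rintro e ⟨γ, -, -, -, rfl⟩
  exact integral_nonneg fun x => sq_nonneg _

lemma IsOptimalSet.ae_eq_of_ae_le {n : ℕ} {α β : Set ℝ} (hP : IsCondensation P nuDisc)
    (hα : IsOptimalSet P n α) (hβ : β.Finite) (hne : β.Nonempty) (hc : β.ncard ≤ n)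
    (h : ∀ᵐ x ∂P, sqDist β x ≤ sqDist α x) : ∀ᵐ x ∂P, sqDist β x = sqDist α x := by
  have hle : ∫ x, sqDist α x ∂P ≤ ∫ x, sqDist β x ∂P := hα.distortion_le hβ hne hc
  have iα := hP.integrable (continuous_sqDist α)
  have iβ := hP.integrable (continuous_sqDist β)
  have h0 : ∫ x, (sqDist α x - sqDist β x) ∂P = 0 := by
    refine le_antisymm ?_ (integral_nonneg_of_ae (h.mono fun x hx => sub_nonneg.2 hx))
    rw [integral_sub iα iβ]
    linarith
  have := (integral_eq_zero_iff_of_nonneg_ae (h.mono fun x hx => sub_nonneg.2 hx)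
    (iα.sub iβ)).1 h0
  filter_upwards [this] with x hx
  exact (sub_eq_zero.1 hx).symm

lemma sqDist_eq_zero {α : Set ℝ} (hf : α.Finite) (hne : α.Nonempty) {x : ℝ}
    (h : sqDist α x = 0) : x ∈ α := by
  obtain ⟨b, hb, hx⟩ := exists_sqDist_eq hf hne x
  have : x = b := by
    rw [h] at hx
    exact sub_eq_zero.1 (pow_eq_zero_iff (two_ne_zero)|>.1 hx.symm)
  exact this ▸ hb

lemma sqDist_anti {α β : Set ℝ} (hne : α.Nonempty) (h : α ⊆ β) (x : ℝ) :
    sqDist β x ≤ sqDist α x :=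
  pow_le_pow_left₀ Metric.infDist_nonneg (Metric.infDist_le_infDist_of_subset h hne) 2

lemma IsCondensation.singleton_ne_zero (hP : IsCondensation P nuDisc) (j : ℕ) :
    P {aseq j} ≠ 0 := by
  rw [hP.apply (measurableSet_singleton _)]
  intro h
  have := (add_eq_zero.1 h).2
  simp [nuDisc_singleton_ne_zero] at this

/-- The Voronoi cell of each point of an optimal set has positive mass. -/
lemma IsOptimalSet.cell_frequently {n : ℕ} {α : Set ℝ} (hP : IsCondensation P nuDisc)
    (hα : IsOptimalSet P n α) {a : ℝ} (ha : a ∈ α) :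
    ∃ᵐ x ∂P, ∀ b ∈ α, (x - a) ^ 2 ≤ (x - b) ^ 2 := by
  have := hP.1
  intro hW
  obtain ⟨hf, hne, hc, -⟩ := id hα
  have hβ : (α \ {a}).Nonempty := by
    obtain ⟨x, hx⟩ := hW.exists
    push Not at hx
    obtain ⟨b, hb, hlt⟩ := hx
    exact ⟨b, hb, fun h => by rw [mem_singleton_iff.1 h] at hlt; exact lt_irrefl _ hlt⟩
  obtain ⟨z, ⟨j, rfl⟩, hz⟩ :=
    (Set.infinite_range_of_injective aseq_strictMono.injective).exists_notMem_finite hf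
  have hsub : α \ {a} ⊆ insert (aseq j) (α \ {a}) := Set.subset_insert _ _
  have hae : ∀ᵐ x ∂P, sqDist (insert (aseq j) (α \ {a})) x ≤ sqDist α x := by
    filter_upwards [hW] with x hx
    refine (sqDist_anti hβ hsub x).trans ?_
    push Not at hx
    obtain ⟨b, hb, hlt⟩ := hx
    obtain ⟨c, hcα, hceq⟩ := exists_sqDist_eq hf hne x
    rw [hceq]
    refine sqDist_le (α := α \ {a}) ⟨hcα, fun h => ?_⟩ x
    have := sqDist_le hb x
    rw [mem_singleton_iff.1 h] at hceq
    linarith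
  have hcard : (insert (aseq j) (α \ {a})).ncard ≤ n := by
    have h1 := Set.ncard_insert_le (aseq j) (α \ {a})
    have h2 := Set.ncard_sdiff_singleton_add_one ha hf
    omega
  have heq := hα.ae_eq_of_ae_le hP (hf.sdiff.insert _) (Set.insert_nonempty _ _) hcard hae
  have hzeq : sqDist (insert (aseq j) (α \ {a})) (aseq j) = sqDist α (aseq j) := by
    by_contra hcon
    exact hP.singleton_ne_zero j (measure_mono_null (by simpa using hcon) (ae_iff.1 heq))
  have h0 := sqDist_le (Set.mem_insert (aseq j) (α \ {a})) (aseq j)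
  rw [sub_self, zero_pow two_ne_zero, hzeq] at h0
  exact hz (sqDist_eq_zero hf hne (le_antisymm h0 (sqDist_nonneg _ _)))

/-- Moving a point of an optimal set cannot bring it closer to almost all of its Voronoi cell. -/
lemma IsOptimalSet.exists_mem_cell {n : ℕ} {α K : Set ℝ} (hP : IsCondensation P nuDisc)
    (hα : IsOptimalSet P n α) (hK : ∀ᵐ x ∂P, x ∈ K) {a : ℝ} (ha : a ∈ α) (a' : ℝ) :
    ∃ x ∈ K, (∀ b ∈ α, (x - a) ^ 2 ≤ (x - b) ^ 2) ∧ (x - a) ^ 2 ≤ (x - a') ^ 2 := by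
  by_contra! hcon
  obtain ⟨hf, hne, hc, -⟩ := id hα
  have hcard : (insert a' (α \ {a})).ncard ≤ n := by
    have h1 := Set.ncard_insert_le a' (α \ {a})
    have h2 := Set.ncard_sdiff_singleton_add_one ha hf
    omega
  have hae : ∀ᵐ x ∂P, sqDist (insert a' (α \ {a})) x ≤ sqDist α x := by
    filter_upwards [hK] with x hx
    obtain ⟨c, hcα, hceq⟩ := exists_sqDist_eq hf hne x
    rw [hceq]
    by_cases hca : c = a
    · subst hca
      exact (sqDist_le (Set.mem_insert _ _) x).trans
        (hcon x hx fun b hb => hceq ▸ sqDist_le hb x).le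
    · have hc : c ∈ α \ {a} := ⟨hcα, hca⟩
      exact sqDist_le (Set.mem_insert_of_mem _ hc) x
  have heq := hα.ae_eq_of_ae_le hP (hf.sdiff.insert _) (Set.insert_nonempty _ _) hcard hae
  obtain ⟨x, hx, hxe, hxK⟩ := ((hα.cell_frequently hP ha).and_eventually (heq.and hK)).exists
  have h1 := hcon x hxK hx
  have h2 := sqDist_le (Set.mem_insert a' (α \ {a})) x
  have h3 : (x - a) ^ 2 ≤ sqDist α x := le_sqDist hf hne hx
  linarith

/-- A point of an optimal set in a gap `(l, r)` of the support has to serve both sides, so the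
other points keep away from it. -/
lemma IsOptimalSet.eq_or_le_or_le {n : ℕ} {α : Set ℝ} (hP : IsCondensation P nuDisc)
    (hα : IsOptimalSet P n α) {l r a : ℝ} (hK : ∀ᵐ x ∂P, x ≤ l ∨ r ≤ x) (ha : a ∈ α)
    (hl : l < a) (hr : a < r) {b : ℝ} (hb : b ∈ α) :
    b = a ∨ b ≤ 2 * l - a ∨ 2 * r - a ≤ b := by
  obtain ⟨x, hx, hxW, hxr⟩ := hα.exists_mem_cell (K := {x | x ≤ l ∨ r ≤ x}) hP hK ha r
  obtain ⟨y, hy, hyW, hyl⟩ := hα.exists_mem_cell (K := {x | x ≤ l ∨ r ≤ x}) hP hK ha l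
  have hxl : x ≤ l := hx.resolve_right fun h => by nlinarith
  have hyr : r ≤ y := hy.resolve_left fun h => by nlinarith
  rcases lt_trichotomy b a with h | h | h
  · have := hxW b hb
    exact Or.inr (Or.inl (by nlinarith))
  · exact Or.inl h
  · have := hyW b hb
    exact Or.inr (Or.inr (by nlinarith))

/-- Three times the distortion, split along the condensation system. -/
lemma IsCondensation.three_mul_distortion (hP : IsCondensation P nuDisc) (α : Set ℝ) :
    3 * distortion P α = ∫ x, sqDist α (x / 5) ∂P + ∫ x, sqDist α (x / 5 + 4 / 5) ∂P +
      ∫ x, sqDist α x ∂nuDisc :=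
  hP.integral_eq (continuous_sqDist α)

lemma IsCondensation.integral_nuDisc_eq_three (hP : IsCondensation P nuDisc) {f : ℝ → ℝ}
    (hf : Continuous f) :
    ∫ x, f x ∂nuDisc = f (2 / 5) / 2 + f (1 / 2) / 4 + f (11 / 20) / 8 +
      (∫ x, f (x / 8 + 21 / 40) ∂nuDisc) / 8 := by
  rw [hP.integral_nuDisc_eq hf, hP.integral_nuDisc_eq (f := fun x => f ((x + 3 / 5) / 2))
    (by fun_prop), hP.integral_nuDisc_eq (f := fun x => f (((x + 3 / 5) / 2 + 3 / 5) / 2))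
    (by fun_prop)]
  have e : ∀ x : ℝ, (((x + 3 / 5) / 2 + 3 / 5) / 2 + 3 / 5) / 2 = x / 8 + 21 / 40 :=
    fun x => by ring
  simp only [e]
  norm_num
  ring

/-! ### Upper bounds from explicit sets -/

lemma IsCondensation.integral_left_le_one (hP : IsCondensation P nuDisc) {β : Set ℝ}
    (h : 19 / 195 ∈ β) : ∫ x, sqDist β (x / 5) ∂P ≤ 86696 / 777231 / 25 := by
  refine (hP.integral_le ((continuous_sqDist β).comp (by fun_prop)) (1 / 5) (-(19 / 195))
    fun x _ => (sqDist_le h (x / 5)).trans_eq (by ring)).trans (by norm_num)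

lemma IsCondensation.integral_right_le_one (hP : IsCondensation P nuDisc) {β : Set ℝ}
    (h : 35 / 39 ∈ β) : ∫ x, sqDist β (x / 5 + 4 / 5) ∂P ≤ 86696 / 777231 / 25 := by
  refine (hP.integral_le ((continuous_sqDist β).comp (by fun_prop)) (1 / 5) (4 / 5 - 35 / 39)
    fun x _ => (sqDist_le h (x / 5 + 4 / 5)).trans_eq (by ring)).trans (by norm_num)

lemma IsCondensation.integral_nuDisc_le_one (hP : IsCondensation P nuDisc) {β : Set ℝ}
    (h : 7 / 15 ∈ β) : ∫ x, sqDist β x ∂nuDisc ≤ 8 / 1575 := by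
  refine (hP.integral_nuDisc_le (continuous_sqDist β) 1 (-(7 / 15))
    fun x _ => (sqDist_le h x).trans_eq (by ring)).trans (by norm_num)

lemma IsCondensation.integral_nuDisc_le_two (hP : IsCondensation P nuDisc) {β : Set ℝ}
    (h : 2 / 5 ∈ β) (h' : 8 / 15 ∈ β) : ∫ x, sqDist β x ∂nuDisc ≤ 1 / 1575 := by
  rw [hP.integral_nuDisc_eq (continuous_sqDist β)]
  have h1 := sqDist_le h (2 / 5)
  have h2 := hP.integral_nuDisc_le (f := fun x => sqDist β ((x + 3 / 5) / 2))
    ((continuous_sqDist β).comp (by fun_prop)) (1 / 2) (3 / 10 - 8 / 15)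
    fun x _ => (sqDist_le h' _).trans_eq (by ring)
  norm_num at h1 h2 ⊢
  linarith

lemma IsCondensation.integral_min_le (hP : IsCondensation P nuDisc) {f : ℝ → ℝ}
    (hf : Continuous f) (h1 : ∀ x, f x ≤ (x - 141 / 500) ^ 2)
    (h2 : ∀ x, f x ≤ (x - 35 / 39) ^ 2) : ∫ x, f x ∂P ≤ 7983000511 / 291461625000 := by
  have h := hP.integral_eq hf
  have i1 := hP.integral_le (f := fun x => f (x / 5)) (by fun_prop) (1 / 5) (-(141 / 500))
    fun x _ => (h1 _).trans_eq (by ring)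
  have i2 := hP.integral_le (f := fun x => f (x / 5 + 4 / 5)) (by fun_prop) (1 / 5)
    (4 / 5 - 35 / 39) fun x _ => (h2 _).trans_eq (by ring)
  have i3 := hP.integral_nuDisc_le hf 1 (-(141 / 500)) fun x _ => (h1 _).trans_eq (by ring)
  norm_num at i1 i2 i3
  linarith

lemma IsCondensation.integral_left_le_two (hP : IsCondensation P nuDisc) {β : Set ℝ}
    (h1 : 141 / 2500 ∈ β) (h2 : 7 / 39 ∈ β) :
    ∫ x, sqDist β (x / 5) ∂P ≤ 7983000511 / 291461625000 / 25 := by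
  have hc := (continuous_sqDist β).comp (g := sqDist β) (f := fun x : ℝ => x / 5) (by fun_prop)
  have := hP.integral_min_le (f := fun x => 25 * sqDist β (x / 5)) (by fun_prop)
    (fun x => by linarith [sqDist_le h1 (x / 5)]) (fun x => by linarith [sqDist_le h2 (x / 5)])
  rw [integral_const_mul] at this
  linarith

lemma IsCondensation.integral_right_le_two (hP : IsCondensation P nuDisc) {β : Set ℝ}
    (h1 : 2141 / 2500 ∈ β) (h2 : 191 / 195 ∈ β) :
    ∫ x, sqDist β (x / 5 + 4 / 5) ∂P ≤ 7983000511 / 291461625000 / 25 := by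
  have hc := (continuous_sqDist β).comp (g := sqDist β) (f := fun x : ℝ => x / 5 + 4 / 5)
    (by fun_prop)
  have := hP.integral_min_le (f := fun x => 25 * sqDist β (x / 5 + 4 / 5)) (by fun_prop)
    (fun x => by linarith [sqDist_le h1 (x / 5 + 4 / 5)])
    (fun x => by linarith [sqDist_le h2 (x / 5 + 4 / 5)])
  rw [integral_const_mul] at this
  linarith

lemma IsOptimalSet.distortion_le_finset {n : ℕ} {α : Set ℝ} (hα : IsOptimalSet P n α)
    (s : Finset ℝ) (hs : s.Nonempty) (hn : s.card ≤ n) : distortion P α ≤ distortion P s :=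
  hα.distortion_le s.finite_toSet hs (by rwa [Set.ncard_coe_finset])

lemma IsOptimalSet.three_mul_distortion_le_of_three {n : ℕ} {α : Set ℝ}
    (hP : IsCondensation P nuDisc) (hα : IsOptimalSet P n α) (hn : 3 ≤ n) :
    3 * distortion P α ≤ 30232 / 2158975 := by
  have h := hα.distortion_le_finset {19 / 195, 7 / 15, 35 / 39} (by simp)
    (Finset.card_le_three.trans hn)
  have h0 := hP.three_mul_distortion ↑({19 / 195, 7 / 15, 35 / 39} : Finset ℝ)
  have h1 := hP.integral_left_le_one (β := ↑({19 / 195, 7 / 15, 35 / 39} : Finset ℝ)) (by simp)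
  have h2 := hP.integral_right_le_one (β := ↑({19 / 195, 7 / 15, 35 / 39} : Finset ℝ)) (by simp)
  have h3 := hP.integral_nuDisc_le_one (β := ↑({19 / 195, 7 / 15, 35 / 39} : Finset ℝ)) (by simp)
  linarith

lemma IsOptimalSet.three_mul_distortion_le_of_four {n : ℕ} {α : Set ℝ}
    (hP : IsCondensation P nuDisc) (hα : IsOptimalSet P n α) (hn : 4 ≤ n) :
    3 * distortion P α ≤ 185729 / 19430775 := by
  set s : Finset ℝ := {19 / 195, 2 / 5, 8 / 15, 35 / 39} with hs
  have h := hα.distortion_le_finset s (by simp [hs]) (Finset.card_le_four.trans hn)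
  have h0 := hP.three_mul_distortion s
  have h1 := hP.integral_left_le_one (β := s) (by simp [hs])
  have h2 := hP.integral_right_le_one (β := s) (by simp [hs])
  have h3 := hP.integral_nuDisc_le_two (β := s) (by simp [hs]) (by simp [hs])
  linarith

lemma IsOptimalSet.three_mul_distortion_le_of_five {n : ℕ} {α : Set ℝ}
    (hP : IsCondensation P nuDisc) (hα : IsOptimalSet P n α) (hn : 5 ≤ n) :
    3 * distortion P α ≤ 45120375511 / 7286540625000 := by
  set s : Finset ℝ := {141 / 2500, 7 / 39, 2 / 5, 8 / 15, 35 / 39} with hs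
  have h := hα.distortion_le_finset s (by simp [hs]) (Finset.card_le_five.trans hn)
  have h0 := hP.three_mul_distortion s
  have h1 := hP.integral_left_le_two (β := s) (by simp [hs]) (by simp [hs])
  have h2 := hP.integral_right_le_one (β := s) (by simp [hs])
  have h3 := hP.integral_nuDisc_le_two (β := s) (by simp [hs]) (by simp [hs])
  linarith

lemma IsOptimalSet.three_mul_distortion_le_of_six {n : ℕ} {α : Set ℝ}
    (hP : IsCondensation P nuDisc) (hα : IsOptimalSet P n α) (hn : 6 ≤ n) :
    3 * distortion P α ≤ 10296188011 / 3643270312500 := by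
  set s : Finset ℝ := {141 / 2500, 7 / 39, 2 / 5, 8 / 15, 2141 / 2500, 191 / 195} with hs
  have h := hα.distortion_le_finset s (by simp [hs]) (Finset.card_le_six.trans hn)
  have h0 := hP.three_mul_distortion s
  have h1 := hP.integral_left_le_two (β := s) (by simp [hs]) (by simp [hs])
  have h2 := hP.integral_right_le_two (β := s) (by simp [hs]) (by simp [hs])
  have h3 := hP.integral_nuDisc_le_two (β := s) (by simp [hs]) (by simp [hs])
  linarith

/-! ### Lower bounds on the pieces -/

lemma sub_max_sq_le {y p : ℝ} (hy : 0 ≤ y) : (y - max p 0) ^ 2 ≤ (y - p) ^ 2 := by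
  rcases le_total p 0 with h | h
  · rw [max_eq_right h]; nlinarith
  · rw [max_eq_left h]

lemma sub_max_sq_le_of_le {y p b : ℝ} (hy : 0 ≤ y) (hy' : y ≤ 1 / 5) (hp : p ≤ 1 / 5)
    (hb : 2 / 5 ≤ b) : (y - max p 0) ^ 2 ≤ (y - b) ^ 2 := by
  have h1 : 0 ≤ max p 0 := le_max_right _ _
  have h2 : max p 0 ≤ 1 / 5 := max_le hp (by norm_num)
  nlinarith

lemma IsCondensation.le_integral_left_one (hP : IsCondensation P nuDisc) {α : Set ℝ}
    (hf : α.Finite) (hne : α.Nonempty) {p : ℝ} (hp : p ≤ 1 / 5)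
    (h : ∀ b ∈ α, b = p ∨ 2 / 5 ≤ b) :
    86696 / 777231 / 25 ≤ ∫ x, sqDist α (x / 5) ∂P := by
  refine le_trans ?_ (hP.le_integral ((continuous_sqDist α).comp (by fun_prop)) (1 / 5)
    (-max p 0) fun x hx => le_sqDist hf hne fun b hb => ?_)
  · nlinarith [sq_nonneg (max p 0 - 19 / 195)]
  · rw [show 1 / 5 * x + -max p 0 = x / 5 - max p 0 by ring]
    rcases h b hb with rfl | h
    · exact sub_max_sq_le (by linarith [hx.1])
    · exact sub_max_sq_le_of_le (by linarith [hx.1]) (by linarith [hx.2]) hp h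

/-- A lower bound for the quantization error of `P` for two points. -/
lemma IsCondensation.le_integral_min (hP : IsCondensation P nuDisc) {f : ℝ → ℝ}
    (hc : Continuous f) (h0 : ∀ x, 0 ≤ f x) {u v : ℝ} (huv : u ≤ v)
    (h : ∀ x ∈ Icc (0 : ℝ) 1, (x - u) ^ 2 ≤ f x ∨ (x - v) ^ 2 ≤ f x) :
    41 / 2500 ≤ ∫ x, f x ∂P := by
  have e := hP.integral_eq hc
  have n1 : 0 ≤ ∫ x, f (x / 5) ∂P := integral_nonneg fun x => h0 _
  have n2 : 0 ≤ ∫ x, f (x / 5 + 4 / 5) ∂P := integral_nonneg fun x => h0 _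
  rcases le_total 1 (u + v) with huv1 | huv1
  · have hu : ∀ x ∈ Icc (0 : ℝ) (1 / 2), (x - u) ^ 2 ≤ f x := by
      intro x hx
      rcases h x ⟨hx.1, by linarith [hx.2]⟩ with h | h
      · exact h
      · nlinarith [hx.2]
    have i1 := hP.le_integral (f := fun x => f (x / 5)) (by fun_prop) (1 / 5) (-u) fun x hx =>
      (show (1 / 5 * x + -u) ^ 2 = (x / 5 - u) ^ 2 by ring) ▸
        hu (x / 5) ⟨by linarith [hx.1], by linarith [hx.2]⟩
    have i2 := hP.integral_nuDisc_eq_three hc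
    have i3 : 0 ≤ ∫ x, f (x / 8 + 21 / 40) ∂nuDisc := integral_nonneg fun x => h0 _
    have i4 := h0 (11 / 20)
    have i5 := hu (2 / 5) (by norm_num)
    have i6 := hu (1 / 2) (by norm_num)
    nlinarith [sq_nonneg (u - 2415 / 10000)]
  · have hv : ∀ x ∈ Icc (1 / 2 : ℝ) 1, (x - v) ^ 2 ≤ f x := by
      intro x hx
      rcases h x ⟨by linarith [hx.1], hx.2⟩ with h | h
      · nlinarith [hx.1]
      · exact h
    have i1 := hP.le_integral (f := fun x => f (x / 5 + 4 / 5)) (by fun_prop) (1 / 5)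
      (4 / 5 - v) fun x hx =>
      (show (1 / 5 * x + (4 / 5 - v)) ^ 2 = (x / 5 + 4 / 5 - v) ^ 2 by ring) ▸
        hv (x / 5 + 4 / 5) ⟨by linarith [hx.1], by linarith [hx.2]⟩
    have i2 := hP.integral_nuDisc_eq hc
    have i3 := hP.le_integral_nuDisc (f := fun x => f ((x + 3 / 5) / 2)) (by fun_prop) (1 / 2)
      (3 / 10 - v) fun x hx =>
      (show (1 / 2 * x + (3 / 10 - v)) ^ 2 = ((x + 3 / 5) / 2 - v) ^ 2 by ring) ▸
        hv ((x + 3 / 5) / 2) ⟨by linarith [hx.1], by linarith [hx.2]⟩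
    have i4 := h0 (2 / 5)
    nlinarith [sq_nonneg (v - 776 / 1000)]

lemma IsCondensation.le_integral_left_two (hP : IsCondensation P nuDisc) {α : Set ℝ}
    (hf : α.Finite) (hne : α.Nonempty) {p g : ℝ} (hp : p ≤ 1 / 5) (hg : g ≤ 1 / 5)
    (h : ∀ b ∈ α, b = p ∨ b = g ∨ 2 / 5 ≤ b) :
    41 / 2500 / 25 ≤ ∫ x, sqDist α (x / 5) ∂P := by
  wlog hpg : p ≤ g generalizing p g
  · exact this hg hp (fun b hb => or_left_comm.1 (h b hb)) (le_of_not_ge hpg)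
  have hc := (continuous_sqDist α).comp (g := sqDist α) (f := fun x : ℝ => x / 5) (by fun_prop)
  have key := hP.le_integral_min (f := fun x => 25 * sqDist α (x / 5)) (by fun_prop)
    (fun x => by linarith [sqDist_nonneg α (x / 5)]) (u := 5 * max p 0) (v := 5 * max g 0)
    (by linarith [max_le_max_right 0 hpg]) fun x hx => by
      have hx0 : 0 ≤ x / 5 := by linarith [hx.1]
      have hx1 : x / 5 ≤ 1 / 5 := by linarith [hx.2]
      rw [show (x - 5 * max p 0) ^ 2 = 25 * (x / 5 - max p 0) ^ 2 by ring,
        show (x - 5 * max g 0) ^ 2 = 25 * (x / 5 - max g 0) ^ 2 by ring]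
      obtain ⟨b, hb, hxb⟩ := exists_sqDist_eq hf hne (x / 5)
      simp only [hxb]
      rcases h b hb with rfl | rfl | h
      · exact Or.inl (by linarith [sub_max_sq_le (p := b) hx0])
      · exact Or.inr (by linarith [sub_max_sq_le (p := b) hx0])
      · exact Or.inl (by linarith [sub_max_sq_le_of_le hx0 hx1 hp h])
  rw [integral_const_mul] at key
  linarith

lemma IsCondensation.le_three_mul_integral_left (hP : IsCondensation P nuDisc) {α : Set ℝ} :
    ∫ x, sqDist α (x / 25 + 4 / 25) ∂P ≤ 3 * ∫ x, sqDist α (x / 5) ∂P := by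
  have hc := (continuous_sqDist α).comp (g := sqDist α) (f := fun x : ℝ => x / 5) (by fun_prop)
  have e := hP.integral_eq (f := fun x => sqDist α (x / 5)) hc
  have n1 : 0 ≤ ∫ x, sqDist α (x / 5 / 5) ∂P := integral_nonneg fun x => sqDist_nonneg _ _
  have n2 : 0 ≤ ∫ x, sqDist α (x / 5) ∂nuDisc := integral_nonneg fun x => sqDist_nonneg _ _
  have e' : ∀ x : ℝ, (x / 5 + 4 / 5) / 5 = x / 25 + 4 / 25 := fun x => by ring
  simp only [e'] at e
  linarith

lemma IsCondensation.le_three_mul_integral_right (hP : IsCondensation P nuDisc) {α : Set ℝ} :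
    ∫ x, sqDist α (x / 25 + 4 / 5) ∂P ≤ 3 * ∫ x, sqDist α (x / 5 + 4 / 5) ∂P := by
  have hc := (continuous_sqDist α).comp (g := sqDist α) (f := fun x : ℝ => x / 5 + 4 / 5)
    (by fun_prop)
  have e := hP.integral_eq (f := fun x => sqDist α (x / 5 + 4 / 5)) hc
  have n1 : 0 ≤ ∫ x, sqDist α ((x / 5 + 4 / 5) / 5 + 4 / 5) ∂P :=
    integral_nonneg fun x => sqDist_nonneg _ _
  have n2 : 0 ≤ ∫ x, sqDist α (x / 5 + 4 / 5) ∂nuDisc :=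
    integral_nonneg fun x => sqDist_nonneg _ _
  have e' : ∀ x : ℝ, x / 5 / 5 + 4 / 5 = x / 25 + 4 / 5 := fun x => by ring
  simp only [e'] at e
  linarith

lemma exists_forall_mem_or_eq {α s : Set ℝ} (hf : α.Finite) (hs : s ⊆ α) (hne : s.Nonempty)
    (hc : α.ncard ≤ s.ncard + 1) : ∃ g ∈ α, ∀ x ∈ α, x ∈ s ∨ x = g := by
  have h1 := Set.ncard_sdiff_add_ncard_of_subset hs hf
  obtain ⟨c, hcs⟩ := hne
  rcases (α \ s).eq_empty_or_nonempty with h | ⟨g, hg⟩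
  · exact ⟨c, hs hcs, fun x hx => Or.inl (by_contra fun hxs => (h ▸ ⟨hx, hxs⟩ : x ∈ (∅ : Set ℝ)))⟩
  · refine ⟨g, hg.1, fun x hx => or_iff_not_imp_left.2 fun hxs => ?_⟩
    exact (Set.ncard_le_one hf.sdiff).1 (by omega) x ⟨hx, hxs⟩ g hg

/-! ### The left gap -/

/-- A point in the left gap makes the left piece and the atom at `2/5` expensive. -/
lemma IsCondensation.le_left_of_mem_gap (hP : IsCondensation P nuDisc) {α : Set ℝ}
    (hf : α.Finite) (hne : α.Nonempty) {a : ℝ} (h1 : 1 / 5 < a) (h2 : a < 2 / 5)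
    (hsep : ∀ b ∈ α, b = a ∨ b ≤ 2 / 5 - a ∨ 4 / 5 - a ≤ b) :
    (65 / 10000 ≤ ∫ x, sqDist α (x / 5) ∂P + sqDist α (2 / 5) / 2) ∧
      (2 / 5 - a) ^ 2 ≤ sqDist α (2 / 5) := by
  have hA : (2 / 5 - a) ^ 2 ≤ sqDist α (2 / 5) := le_sqDist hf hne fun b hb => by
    rcases hsep b hb with rfl | h | h <;> nlinarith
  refine ⟨?_, hA⟩
  rcases le_total (2 / 5 - a) (4 / 25) with hd | hd
  · have i1 := hP.le_integral (f := fun x => sqDist α (x / 25 + 4 / 25))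
      ((continuous_sqDist α).comp (by fun_prop)) (1 / 25) (4 / 25 - (2 / 5 - a))
      fun x hx => le_sqDist hf hne fun b hb => by
        have := hx.1
        have := hx.2
        rcases hsep b hb with rfl | h | h <;> nlinarith
    have i2 := hP.le_three_mul_integral_left (α := α)
    nlinarith [sq_nonneg (2 / 5 - a - 718 / 10000)]
  · have i1 : 0 ≤ ∫ x, sqDist α (x / 5) ∂P := integral_nonneg fun x => sqDist_nonneg _ _
    nlinarith

/-- If a single point `e` beyond `3/4` and a point `g` in `(2/5, 7/10)` have to serve everything
from `1/2` on, then the right piece and the atom at `1/2` are expensive. -/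
lemma IsCondensation.le_right_of_forall_or_eq (hP : IsCondensation P nuDisc) {α : Set ℝ}
    (hf : α.Finite) (hne : α.Nonempty) {e g : ℝ} (hg : 2 / 5 < g) (hg' : g < 7 / 10)
    (he : 3 / 4 < e) (h : ∀ b ∈ α, b ≤ 2 / 5 ∨ b = e ∨ b = g) :
    44 / 10000 ≤ ∫ x, sqDist α (x / 5 + 4 / 5) ∂P + sqDist α (1 / 2) / 4 := by
  have hB := sqDist_nonneg α (1 / 2)
  have single : (∀ y ∈ Icc (4 / 5 : ℝ) 1, (y - e) ^ 2 ≤ (y - g) ^ 2) →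
      44 / 10000 ≤ ∫ x, sqDist α (x / 5 + 4 / 5) ∂P + sqDist α (1 / 2) / 4 := by
    intro hy
    have i1 := hP.le_integral (f := fun x => sqDist α (x / 5 + 4 / 5))
      ((continuous_sqDist α).comp (by fun_prop)) (1 / 5) (4 / 5 - e)
      fun x hx => le_sqDist hf hne fun b hb => by
        have hx0 := hx.1
        have := hy (x / 5 + 4 / 5) ⟨by linarith [hx.1], by linarith [hx.2]⟩
        rcases h b hb with h | rfl | rfl <;> nlinarith
    nlinarith [sq_nonneg (e - 35 / 39)]
  rcases le_total e (9 / 10) with he9 | he9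
  · exact single fun y hy => by nlinarith [hy.1]
  rcases le_total (3 / 5) g with hg6 | hg6
  · have i1 := hP.le_integral (f := fun x => sqDist α (x / 25 + 4 / 5))
      ((continuous_sqDist α).comp (by fun_prop)) (-(1 / 25)) (1 / 10)
      fun x hx => sq_le_sqDist hf hne (by linarith [hx.2]) fun b hb => by
        rcases h b hb with h | rfl | rfl
        · exact Or.inl (by linarith [hx.1])
        · exact Or.inr (by linarith)
        · exact Or.inl (by linarith [hx.1])
    have i2 := hP.le_three_mul_integral_right (α := α)
    have i3 : (1 / 10) ^ 2 ≤ sqDist α (1 / 2) :=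
      sq_le_sqDist hf hne (by norm_num) fun b hb => by
        rcases h b hb with h | rfl | rfl
        · exact Or.inl (by linarith)
        · exact Or.inr (by linarith)
        · exact Or.inr (by linarith)
    linarith
  rcases le_total e 1 with he1 | he1
  · exact single fun y hy => by nlinarith [hy.1, hy.2]
  · have i1 := hP.le_integral (f := fun x => sqDist α (x / 5 + 4 / 5))
      ((continuous_sqDist α).comp (by fun_prop)) (-(1 / 5)) (1 / 5)
      fun x hx => sq_le_sqDist hf hne (by linarith [hx.2]) fun b hb => by
        rcases h b hb with h | rfl | rfl
        · exact Or.inl (by linarith [hx.1])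
        · exact Or.inr (by linarith)
        · exact Or.inl (by linarith [hx.1])
    linarith

lemma IsOptimalSet.notMem_left_gap {n : ℕ} {α : Set ℝ} (hP : IsCondensation P nuDisc)
    (hα : IsOptimalSet P n α) (hn : 3 ≤ n) {a : ℝ} (ha : a ∈ α) (h1 : 1 / 5 < a)
    (h2 : a < 2 / 5) : False := by
  obtain ⟨hf, hne, hcard, -⟩ := id hα
  have hsep : ∀ b ∈ α, b = a ∨ b ≤ 2 / 5 - a ∨ 4 / 5 - a ≤ b := fun b hb => by
    have := hα.eq_or_le_or_le hP (l := 1 / 5) (r := 2 / 5) (hP.ae_mem_pieces.mono ?_) ha h1 h2 hb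
    · norm_num at this ⊢
      exact this
    · rintro x ((hx | hx) | hx)
      · exact Or.inl hx.2
      · exact Or.inr hx.1
      · exact Or.inr (by linarith [hx.1])
  obtain ⟨hL, hA⟩ := hP.le_left_of_mem_gap hf hne h1 h2 hsep
  have hD := hP.three_mul_distortion α
  have hC := hP.integral_nuDisc_eq_three (continuous_sqDist α)
  have hJ1 : 0 ≤ ∫ x, sqDist α (x / 5) ∂P := integral_nonneg fun x => sqDist_nonneg _ _
  have hJ2 : 0 ≤ ∫ x, sqDist α (x / 5 + 4 / 5) ∂P := integral_nonneg fun x => sqDist_nonneg _ _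
  have hB := sqDist_nonneg α (1 / 2)
  have hB' := sqDist_nonneg α (11 / 20)
  have hT : 0 ≤ ∫ x, sqDist α (x / 8 + 21 / 40) ∂nuDisc :=
    integral_nonneg fun x => sqDist_nonneg _ _
  have hV3 := hα.three_mul_distortion_le_of_three hP hn
  obtain ⟨b, hb, hba⟩ : ∃ b ∈ α, b ≤ 2 / 5 - a := by
    by_contra! hcon
    have i1 := hP.le_integral (f := fun x => sqDist α (x / 5))
      ((continuous_sqDist α).comp (by fun_prop)) (-(1 / 5)) a
      fun x hx => sq_le_sqDist hf hne (by linarith [hx.2]) fun b hb => Or.inr <| by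
        rcases hsep b hb with rfl | h | h <;> linarith [hcon b hb]
    nlinarith [sq_nonneg (a - 3 / 10)]
  obtain ⟨e, he, hea⟩ : ∃ e ∈ α, 3 / 4 < e := by
    by_contra! hcon
    have i1 := hP.le_integral (f := fun x => sqDist α (x / 5 + 4 / 5))
      ((continuous_sqDist α).comp (by fun_prop)) (1 / 5) (1 / 20)
      fun x hx => sq_le_sqDist hf hne (by linarith [hx.1]) fun b hb =>
        Or.inl (by linarith [hcon b hb])
    linarith
  have hs : ({b, a, e} : Set ℝ).ncard = 3 :=
    Set.ncard_eq_three.2 ⟨b, a, e, by linarith, by linarith, by linarith, rfl⟩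
  have hsub : ({b, a, e} : Set ℝ) ⊆ α := by
    rintro x (rfl | rfl | rfl) <;> assumption
  have hfar : (∀ x ∈ α, x ≤ 2 / 5 ∨ 7 / 10 ≤ x) → (1 / 10) ^ 2 ≤ sqDist α (1 / 2) ∧
      (3 / 20) ^ 2 ≤ sqDist α (11 / 20) := fun h =>
    ⟨sq_le_sqDist hf hne (by norm_num) fun b hb =>
        (h b hb).imp (fun h => by linarith) fun h => by linarith,
      sq_le_sqDist hf hne (by norm_num) fun b hb =>
        (h b hb).imp (fun h => by linarith) fun h => by linarith⟩
  rcases Nat.lt_or_ge n 4 with h4 | h4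
  · have heq : ({b, a, e} : Set ℝ) = α := Set.eq_of_subset_of_ncard_le hsub (by omega) hf
    have hcase : ∀ x ∈ α, x ≤ 2 / 5 ∨ 3 / 4 ≤ x := by
      rw [← heq]
      rintro x (rfl | rfl | rfl)
      · exact Or.inl (by linarith)
      · exact Or.inl (by linarith)
      · exact Or.inr hea.le
    obtain ⟨i1, i2⟩ := hfar fun x hx => (hcase x hx).imp_right fun h => by linarith
    have i3 := hP.le_integral_nuDisc (f := fun x => sqDist α (x / 8 + 21 / 40))
      ((continuous_sqDist α).comp (by fun_prop)) 0 (3 / 20)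
      fun x hx => sq_le_sqDist hf hne (by linarith) fun b hb =>
        (hcase b hb).imp (fun h => by linarith [hx.1]) fun h => by linarith [hx.2]
    linarith
  have hV4 := hα.three_mul_distortion_le_of_four hP h4
  rcases Nat.lt_or_ge n 5 with h5 | h5
  · obtain ⟨g, hg, hall⟩ := exists_forall_mem_or_eq hf hsub ⟨a, by simp⟩ (by omega)
    have hall' : ∀ x ∈ α, x ≤ 2 / 5 ∨ x = e ∨ x = g := by
      intro x hx
      rcases hall x hx with (rfl | rfl | rfl) | h
      · exact Or.inl (by linarith)
      · exact Or.inl (by linarith)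
      · exact Or.inr (Or.inl rfl)
      · exact Or.inr (Or.inr h)
    by_cases hg' : g ≤ 2 / 5 ∨ 7 / 10 ≤ g
    · obtain ⟨i1, i2⟩ := hfar fun x hx => by
        rcases hall' x hx with h | rfl | rfl
        · exact Or.inl h
        · exact Or.inr (by linarith)
        · exact hg'
      linarith
    push Not at hg'
    linarith [hP.le_right_of_forall_or_eq hf hne hg'.1 hg'.2 hea hall']
  · have hV5 := hα.three_mul_distortion_le_of_five hP h5
    linarith

/-! ### The right gap -/

/-- The costs forced by a point `3/5 + d` in the right gap. -/
lemma IsCondensation.le_right_of_mem_gap (hP : IsCondensation P nuDisc) {α : Set ℝ}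
    (hf : α.Finite) (hne : α.Nonempty) {d : ℝ} (h1 : 0 < d) (h2 : d < 1 / 5)
    (hsep : ∀ b ∈ α, b = 3 / 5 + d ∨ b ≤ 3 / 5 - d ∨ 1 - d ≤ b) :
    (d ≤ 4 / 25 → ((1 / 25) ^ 2 * (6953 / 19929) + 2 * (1 / 25) * (d - 1 / 5) * (19 / 39) +
      (d - 1 / 5) ^ 2) / 3 ≤ ∫ x, sqDist α (x / 5 + 4 / 5) ∂P) ∧
    (1 / 40 ≤ d → (1 / 8) ^ 2 * (39 / 175) + 2 * (1 / 8) * (d - 3 / 40) * (7 / 15) +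
      (d - 3 / 40) ^ 2 ≤ ∫ x, sqDist α (x / 8 + 21 / 40) ∂nuDisc) ∧
    (1 / 20 ≤ d → (d - 1 / 20) ^ 2 ≤ sqDist α (11 / 20)) := by
  refine ⟨fun hd => ?_, fun hd => ?_, fun hd => ?_⟩
  · have i1 := hP.le_integral (f := fun x => sqDist α (x / 25 + 4 / 5))
      ((continuous_sqDist α).comp (by fun_prop)) (1 / 25) (d - 1 / 5)
      fun x hx => le_sqDist hf hne fun b hb => by
        have := hx.1
        have := hx.2
        rcases hsep b hb with rfl | h | h <;> nlinarith
    have i2 := hP.le_three_mul_integral_right (α := α)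
    linarith
  · exact hP.le_integral_nuDisc (f := fun x => sqDist α (x / 8 + 21 / 40))
      ((continuous_sqDist α).comp (by fun_prop)) (1 / 8) (d - 3 / 40)
      fun x hx => le_sqDist hf hne fun b hb => by
        have := hx.1
        have := hx.2
        rcases hsep b hb with rfl | h | h <;> nlinarith
  · exact le_sqDist hf hne fun b hb => by
      rcases hsep b hb with rfl | h | h <;> nlinarith

/-- The cost of the middle and right pieces when `c` alone serves the middle together with a point
`3/5 + d` in the right gap. -/
lemma IsCondensation.le_middle_right_of_single (hP : IsCondensation P nuDisc) {α : Set ℝ}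
    (hf : α.Finite) (hne : α.Nonempty) {c d : ℝ} (h1 : 0 < d) (h2 : d < 1 / 5)
    (hsep : ∀ b ∈ α, b = 3 / 5 + d ∨ b ≤ 3 / 5 - d ∨ 1 - d ≤ b) (hc : 2 / 5 ≤ c)
    (hc' : c ≤ 3 / 5 - d) (hone : ∀ b ∈ α, b ≤ 1 / 5 ∨ b = c ∨ 3 / 5 + d ≤ b) :
    56 / 10000 ≤ ∫ x, sqDist α (x / 5 + 4 / 5) ∂P + ∫ x, sqDist α x ∂nuDisc := by
  obtain ⟨hJ, hT, -⟩ := hP.le_right_of_mem_gap hf hne h1 h2 hsep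
  have hC := hP.integral_nuDisc_eq_three (continuous_sqDist α)
  have hJ0 : 0 ≤ ∫ x, sqDist α (x / 5 + 4 / 5) ∂P := integral_nonneg fun x => sqDist_nonneg _ _
  have hB0 := sqDist_nonneg α (1 / 2)
  have hB0' := sqDist_nonneg α (11 / 20)
  have hT0 : 0 ≤ ∫ x, sqDist α (x / 8 + 21 / 40) ∂nuDisc :=
    integral_nonneg fun x => sqDist_nonneg _ _
  have hA : (c - 2 / 5) ^ 2 ≤ sqDist α (2 / 5) := le_sqDist hf hne fun b hb => by
    rcases hone b hb with h | rfl | h <;> nlinarith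
  have hB : (c - 1 / 2) ^ 2 ≤ sqDist α (1 / 2) ∨ (1 / 10 + d) ^ 2 ≤ sqDist α (1 / 2) := by
    obtain ⟨b, hb, hx⟩ := exists_sqDist_eq hf hne (1 / 2)
    rw [hx]
    rcases hone b hb with h | rfl | h
    · exact Or.inr (by nlinarith)
    · exact Or.inl (by nlinarith)
    · exact Or.inr (by nlinarith)
  have hB' : (c - 11 / 20) ^ 2 ≤ sqDist α (11 / 20) ∨
      (1 / 20 + d) ^ 2 ≤ sqDist α (11 / 20) := by
    obtain ⟨b, hb, hx⟩ := exists_sqDist_eq hf hne (11 / 20)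
    rw [hx]
    rcases hone b hb with h | rfl | h
    · exact Or.inr (by nlinarith)
    · exact Or.inl (by nlinarith)
    · exact Or.inr (by nlinarith)
  rcases le_total d (1 / 40) with hd | hd
  · have := hJ (by linarith)
    nlinarith
  have hT := hT hd
  rcases le_total d (4 / 25) with hd' | hd'
  · have hJ := hJ hd'
    rcases hB with hB | hB
    · rcases hB' with hB' | hB'
      · nlinarith [sq_nonneg (c - 9 / 20), sq_nonneg (d - 1358 / 10000)]
      · nlinarith [sq_nonneg (c - 13 / 30), sq_nonneg (d - 1 / 10)]
    · nlinarith [sq_nonneg (d - 6 / 100)]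
  · rcases hB with hB | hB
    · rcases hB' with hB' | hB'
      · nlinarith [sq_nonneg (c - 9 / 20)]
      · nlinarith [sq_nonneg (c - 13 / 30)]
    · nlinarith

lemma IsOptimalSet.notMem_right_gap {n : ℕ} {α : Set ℝ} (hP : IsCondensation P nuDisc)
    (hα : IsOptimalSet P n α) (hn : 3 ≤ n) {a : ℝ} (ha : a ∈ α) (h1 : 3 / 5 < a)
    (h2 : a < 4 / 5) : False := by
  obtain ⟨hf, hne, hcard, -⟩ := id hα
  obtain ⟨d, rfl⟩ : ∃ d, a = 3 / 5 + d := ⟨a - 3 / 5, by ring⟩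
  have hd0 : 0 < d := by linarith
  have hd1 : d < 1 / 5 := by linarith
  have hleft : ∀ b ∈ α, b ≤ 1 / 5 ∨ 2 / 5 ≤ b := fun b hb => by
    by_contra! h
    exact hα.notMem_left_gap hP hn hb h.1 h.2
  have hsep : ∀ b ∈ α, b = 3 / 5 + d ∨ b ≤ 3 / 5 - d ∨ 1 - d ≤ b := fun b hb => by
    have hK : ∀ᵐ x ∂P, x ≤ 3 / 5 ∨ 4 / 5 ≤ x := by
      filter_upwards [hP.ae_mem_pieces] with x hx
      rcases hx with (hx | hx) | hx
      exacts [Or.inl (by linarith [hx.2]), Or.inl hx.2, Or.inr hx.1]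
    rcases hα.eq_or_le_or_le hP hK ha h1 h2 hb with h | h | h
    · exact Or.inl h
    · exact Or.inr (Or.inl (by linarith))
    · exact Or.inr (Or.inr (by linarith))
  obtain ⟨hJ, hT, hF⟩ := hP.le_right_of_mem_gap hf hne hd0 hd1 hsep
  have hD := hP.three_mul_distortion α
  have hC := hP.integral_nuDisc_eq_three (continuous_sqDist α)
  have hJ1 : 0 ≤ ∫ x, sqDist α (x / 5) ∂P := integral_nonneg fun x => sqDist_nonneg _ _
  have hJ2 : 0 ≤ ∫ x, sqDist α (x / 5 + 4 / 5) ∂P := integral_nonneg fun x => sqDist_nonneg _ _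
  have hA0 := sqDist_nonneg α (2 / 5)
  have hB0 := sqDist_nonneg α (1 / 2)
  have hB0' := sqDist_nonneg α (11 / 20)
  have hT0 : 0 ≤ ∫ x, sqDist α (x / 8 + 21 / 40) ∂nuDisc :=
    integral_nonneg fun x => sqDist_nonneg _ _
  have hC0 : 4 / 25 ≤ d → 4 / 1000 ≤ ∫ x, sqDist α x ∂nuDisc := fun hd => by
    have := hT (by linarith)
    have := hF (by linarith)
    nlinarith
  have hR : 32 / 10000 ≤ ∫ x, sqDist α (x / 5 + 4 / 5) ∂P + ∫ x, sqDist α x ∂nuDisc := by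
    rcases le_total d (4 / 25) with hd | hd
    · have hJ := hJ hd
      rcases le_total d (1 / 20) with hd' | hd'
      · nlinarith
      · have := hT (by linarith)
        have := hF hd'
        nlinarith [sq_nonneg (d - 1174 / 10000)]
    · linarith [hC0 hd]
  have hV3 := hα.three_mul_distortion_le_of_three hP hn
  obtain ⟨p, hp, hp'⟩ : ∃ p ∈ α, p ≤ 1 / 5 := by
    by_contra! hcon
    have i1 := hP.le_integral (f := fun x => sqDist α (x / 5))
      ((continuous_sqDist α).comp (by fun_prop)) (-(1 / 5)) (2 / 5)
      fun x hx => sq_le_sqDist hf hne (by linarith [hx.2]) fun b hb => Or.inr <| by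
        linarith [(hleft b hb).resolve_left (not_le.2 (hcon b hb))]
    linarith
  obtain ⟨c, hc, hc1, hc2⟩ : ∃ c ∈ α, 2 / 5 ≤ c ∧ c ≤ 3 / 5 - d := by
    by_contra! hcon
    have : (1 / 5) ^ 2 ≤ sqDist α (2 / 5) := sq_le_sqDist hf hne (by norm_num) fun b hb => by
      rcases hleft b hb with h | h
      · exact Or.inl (by linarith)
      · have := hcon b hb h
        rcases hsep b hb with rfl | h | h <;> exact Or.inr (by linarith)
    linarith
  obtain ⟨b, hb, hb'⟩ : ∃ b ∈ α, 1 - d ≤ b := by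
    by_contra! hcon
    have i1 := hP.le_integral (f := fun x => sqDist α (x / 5 + 4 / 5))
      ((continuous_sqDist α).comp (by fun_prop)) (1 / 5) (1 / 5 - d)
      fun x hx => sq_le_sqDist hf hne (by linarith [hx.1]) fun b hb => Or.inl <| by
        have := hcon b hb
        rcases hsep b hb with rfl | h | h <;> linarith [hx.1]
    rcases le_total d (4 / 25) with hd | hd
    · nlinarith
    · have := hC0 hd
      nlinarith
  have hs : ({p, c, 3 / 5 + d, b} : Set ℝ).ncard = 4 := by
    rw [Set.ncard_insert_of_notMem, Set.ncard_eq_three.2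
      ⟨c, 3 / 5 + d, b, by linarith, by linarith, by linarith, rfl⟩]
    rintro (h | h | h)
    · linarith
    · linarith
    · linarith [mem_singleton_iff.1 h]
  have hsub : ({p, c, 3 / 5 + d, b} : Set ℝ) ⊆ α := by
    rintro x (rfl | rfl | rfl | rfl) <;> assumption
  have h4 : 4 ≤ n := by
    have := Set.ncard_le_ncard hsub hf
    omega
  have hV4 := hα.three_mul_distortion_le_of_four hP h4
  rcases Nat.lt_or_ge n 5 with h5 | h5
  · have heq : ({p, c, 3 / 5 + d, b} : Set ℝ) = α :=
      Set.eq_of_subset_of_ncard_le hsub (by omega) hf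
    have hX := hP.le_middle_right_of_single hf hne hd0 hd1 hsep hc1 hc2 fun x hx => by
      rw [← heq] at hx
      rcases hx with rfl | rfl | rfl | rfl
      · exact Or.inl hp'
      · exact Or.inr (Or.inl rfl)
      · exact Or.inr (Or.inr le_rfl)
      · exact Or.inr (Or.inr (by linarith))
    have hone := hP.le_integral_left_one hf hne hp' fun x hx => by
      rw [← heq] at hx
      rcases hx with rfl | rfl | rfl | rfl
      · exact Or.inl rfl
      · exact Or.inr hc1
      · exact Or.inr (by linarith)
      · exact Or.inr (by linarith)
    linarith
  have hV5 := hα.three_mul_distortion_le_of_five hP h5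
  rcases Nat.lt_or_ge n 6 with h6 | h6
  · obtain ⟨g, hg, hall⟩ := exists_forall_mem_or_eq hf hsub ⟨p, by simp⟩ (by omega)
    rcases hleft g hg with hg' | hg'
    · have hX := hP.le_middle_right_of_single hf hne hd0 hd1 hsep hc1 hc2 fun x hx => by
        rcases hall x hx with (rfl | rfl | rfl | rfl) | rfl
        · exact Or.inl hp'
        · exact Or.inr (Or.inl rfl)
        · exact Or.inr (Or.inr le_rfl)
        · exact Or.inr (Or.inr (by linarith))
        · exact Or.inl hg'
      have htwo := hP.le_integral_left_two hf hne hp' hg' fun x hx => by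
        rcases hall x hx with (rfl | rfl | rfl | rfl) | rfl
        · exact Or.inl rfl
        · exact Or.inr (Or.inr hc1)
        · exact Or.inr (Or.inr (by linarith))
        · exact Or.inr (Or.inr (by linarith))
        · exact Or.inr (Or.inl rfl)
      linarith
    · have hone := hP.le_integral_left_one hf hne hp' fun x hx => by
        rcases hall x hx with (rfl | rfl | rfl | rfl) | rfl
        · exact Or.inl rfl
        · exact Or.inr hc1
        · exact Or.inr (by linarith)
        · exact Or.inr (by linarith)
        · exact Or.inr hg'
      linarith
  · have hV6 := hα.three_mul_distortion_le_of_six hP h6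
    linarith

end Condensation

theorem optimal_sets_avoid_gaps_discrete (P : MeasureTheory.Measure ℝ)
    (hP : IsCondensation P nuDisc) :
    ∀ n : ℕ, 3 ≤ n → ∀ α : Set ℝ, IsOptimalSet P n α →
      α ∩ Set.Ioo (1 / 5 : ℝ) (2 / 5) = ∅ ∧ α ∩ Set.Ioo (3 / 5 : ℝ) (4 / 5) = ∅ := by
  intro n hn α hα
  exact ⟨Set.eq_empty_of_forall_notMem fun a ha =>
      hα.notMem_left_gap hP hn ha.1 ha.2.1 ha.2.2,
    Set.eq_empty_of_forall_notMem fun a ha =>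
      hα.notMem_right_gap hP hn ha.1 ha.2.1 ha.2.2⟩
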